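/- Let γ, δ : ℝ → ℝ^{d} be differentiable curves and α, β : ℝ → ℝ continuous functions such that γ'(t) = α(t)·δ(t) and δ'(t) = β(t)·γ(t) for all t. Then for every t₀ and t, both γ(t) and δ(t) lie in the linear span of {γ(t₀), δ(t₀)}; in particular γ and δ are planar curves. (This is the core of the theorem that if a characteristic curve γ on the boundary of a C²-smooth symplectically self-polar convex body is mapped by f to another characteristic curve δ = f∘γ, then γ and δ are planar.) -/

import Mathlib

section CoupledLinearSystem

variable {E : Type*} [NormedAddCommGroup E] [NormedSpace ℝ E]

/-- A solution of `u' = α v`, `v' = β u` vanishing at `t₀` vanishes at all later times. -/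
theorem coupled_linear_eq_zero_of_le {u v : ℝ → E} {α β : ℝ → ℝ}
    (hα : Continuous α) (hβ : Continuous β)
    (hu : ∀ t, HasDerivAt u (α t • v t) t) (hv : ∀ t, HasDerivAt v (β t • u t) t)
    {t₀ t : ℝ} (hu₀ : u t₀ = 0) (hv₀ : v t₀ = 0) (ht : t₀ ≤ t) :
    u t = 0 ∧ v t = 0 := by
  obtain ⟨A, hA⟩ := (isCompact_Icc (a := t₀) (b := t)).exists_bound_of_continuousOn
    hα.continuousOn
  obtain ⟨B, hB⟩ := (isCompact_Icc (a := t₀) (b := t)).exists_bound_of_continuousOn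
    hβ.continuousOn
  have hd : ∀ s, HasDerivAt (fun s => (u s, v s)) (α s • v s, β s • u s) s :=
    fun s => (hu s).prodMk (hv s)
  have key := eq_zero_of_abs_deriv_le_mul_abs_self_of_eq_zero_right
    (f := fun s => (u s, v s)) (K := max A B) (a := t₀) (b := t)
    (fun s _ => (hd s).continuousAt.continuousWithinAt)
    (fun s _ => (hd s).hasDerivWithinAt) (by simp [hu₀, hv₀])
    (fun s hs => by
      have hs' := Set.Ico_subset_Icc_self hs
      have hK : 0 ≤ max A B := (norm_nonneg _).trans ((hA s hs').trans (le_max_left A B))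
      refine norm_prod_le_iff.2 ⟨?_, ?_⟩
      · rw [norm_smul]
        exact mul_le_mul ((hA s hs').trans (le_max_left A B))
          (norm_snd_le (u s, v s)) (norm_nonneg _) hK
      · rw [norm_smul]
        exact mul_le_mul ((hB s hs').trans (le_max_right A B))
          (norm_fst_le (u s, v s)) (norm_nonneg _) hK)
    t (Set.right_mem_Icc.2 ht)
  simpa using key

/-- A solution of `u' = α v`, `v' = β u` vanishing at one time vanishes identically. -/
theorem coupled_linear_eq_zero {u v : ℝ → E} {α β : ℝ → ℝ}
    (hα : Continuous α) (hβ : Continuous β)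
    (hu : ∀ t, HasDerivAt u (α t • v t) t) (hv : ∀ t, HasDerivAt v (β t • u t) t)
    {t₀ : ℝ} (hu₀ : u t₀ = 0) (hv₀ : v t₀ = 0) (t : ℝ) :
    u t = 0 ∧ v t = 0 := by
  rcases le_total t₀ t with ht | ht
  · exact coupled_linear_eq_zero_of_le hα hβ hu hv hu₀ hv₀ ht
  · have h := coupled_linear_eq_zero_of_le (u := fun s => u (-s)) (v := fun s => v (-s))
      (α := fun s => -α (-s)) (β := fun s => -β (-s)) (t₀ := -t₀) (t := -t)
      (by fun_prop) (by fun_prop)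
      (fun s => by simpa [Function.comp_def] using (hu (-s)).scomp s (hasDerivAt_neg s))
      (fun s => by simpa [Function.comp_def] using (hv (-s)).scomp s (hasDerivAt_neg s))
      (by simpa using hu₀) (by simpa using hv₀) (neg_le_neg ht)
    simpa using h

end CoupledLinearSystem

/-- If γ, δ : ℝ → ℝ^d are differentiable curves with γ'(t) = α(t)·δ(t) and
δ'(t) = β(t)·γ(t) for continuous α, β : ℝ → ℝ, then for every t₀ and t both γ(t) and
δ(t) lie in the linear span of {γ(t₀), δ(t₀)}; in particular γ and δ are planar curves. -/
theorem characteristic_curves_planar {d : ℕ} (γ δ : ℝ → EuclideanSpace ℝ (Fin d))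
    (α β : ℝ → ℝ) (hα : Continuous α) (hβ : Continuous β)
    (hγ : ∀ t : ℝ, HasDerivAt γ (α t • δ t) t)
    (hδ : ∀ t : ℝ, HasDerivAt δ (β t • γ t) t) :
    ∀ t₀ t : ℝ,
      γ t ∈ Submodule.span ℝ ({γ t₀, δ t₀} : Set (EuclideanSpace ℝ (Fin d))) ∧
      δ t ∈ Submodule.span ℝ ({γ t₀, δ t₀} : Set (EuclideanSpace ℝ (Fin d))) := by
  intro t₀ t
  set W := Submodule.span ℝ ({γ t₀, δ t₀} : Set (EuclideanSpace ℝ (Fin d)))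
  have hγW : γ t₀ ∈ W := Submodule.subset_span (by simp)
  have hδW : δ t₀ ∈ W := Submodule.subset_span (by simp)
  have key : ∀ x ∈ Wᗮ, inner ℝ x (γ t) = 0 ∧ inner ℝ x (δ t) = 0 := fun x hx =>
    coupled_linear_eq_zero (u := fun s => inner ℝ x (γ s)) (v := fun s => inner ℝ x (δ s))
      hα hβ
      (fun s => by
        simpa [Function.comp_def] using (innerSL ℝ x).hasFDerivAt.comp_hasDerivAt s (hγ s))
      (fun s => by
        simpa [Function.comp_def] using (innerSL ℝ x).hasFDerivAt.comp_hasDerivAt s (hδ s))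
      (Submodule.inner_left_of_mem_orthogonal hγW hx)
      (Submodule.inner_left_of_mem_orthogonal hδW hx) t
  rw [← Submodule.orthogonal_orthogonal W]
  exact ⟨(Submodule.mem_orthogonal _ _).2 fun x hx => (key x hx).1,
    (Submodule.mem_orthogonal _ _).2 fun x hx => (key x hx).2⟩
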